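/- Let d = 1, m > 0, γ ∈ [0,1), and f(x) := e^{−m|x|}|x|^{−γ}. Let M₂ := (C₁ ∨ C₂)·‖f‖₁ where C₁, C₂ ≥ 1 are constants such that f(x) ≤ C₁ f(y) whenever 1 ≤ |x| ≤ |y| ≤ |x|+1 and f(x) ≤ C₂ f(2x) for |x| ≤ 1. Then for every |x| ≥ 1 and λ > 0: 1 ≤ p_λ(x) / ( e^{−λ‖f‖₁} e^{−m|x|} |x|^{−1} φ(1−γ, 0; Γ(1−γ) λ |x|^{1−γ}) ) ≤ e^{M₂λ}. In particular, there are positive constants E₁, E₂, E₃, E₄ depending only on γ and m such that: if λ|x|^{1−γ} ≤ 1 then E₁ ≤ p_λ(x)/(λ e^{−λ‖f‖₁} e^{−m|x|}|x|^{−γ}) ≤ E₂; and if λ|x|^{1−γ} ≥ 1 then E₃ ≤ p_λ(x) / ( λ^{1/(4−2γ)} |x|^{−(3−γ)/(4−2γ)} exp(−λ‖f‖₁ − m|x| + ((2−γ)/(1−γ)) (Γ(2−γ) λ |x|^{1−γ})^{1/(2−γ)}) ) ≤ E₄ e^{M₂λ}. -/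

import Mathlib

open MeasureTheory Filter Topology ENNReal Set

noncomputable section

/-- `iterConv1 f n` is the `(n+1)`-fold convolution `f^{(n+1)⋆}` on `ℝ`. -/
def iterConv1 (f : ℝ → ℝ≥0∞) : ℕ → ℝ → ℝ≥0∞
  | 0 => f
  | n + 1 => fun x => ∫⁻ y, f (x - y) * iterConv1 f n y

/-- The density `p_λ(x) = e^{-λ‖f‖₁} ∑_{n=1}^∞ λⁿ f^{n⋆}(x)/n!` on `ℝ`. -/
def pdens1 (f : ℝ → ℝ≥0∞) (lam : ℝ) (x : ℝ) : ℝ≥0∞ :=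
  ENNReal.ofReal (Real.exp (-(lam * (∫⁻ y, f y).toReal))) *
    ∑' n : ℕ, ENNReal.ofReal lam ^ (n + 1) * iterConv1 f n x / (Nat.factorial (n + 1) : ℝ≥0∞)

/-- The generalized Bessel (Wright) function `φ(ρ,β;t) = ∑_{n≥0} tⁿ/(Γ(ρn+β) n!)`.
(In Mathlib `Real.Gamma 0 = 0` and `x / 0 = 0`, so the convention `1/Γ(0) = 0` holds.) -/
def wright (ρ β t : ℝ) : ℝ :=
  ∑' n : ℕ, t ^ n / (Real.Gamma (ρ * n + β) * (Nat.factorial n : ℝ))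

/-- Ratio of Gamma to its Stirling approximation. -/
def SG (x : ℝ) : ℝ := Real.Gamma x * Real.exp (x - (x - 1/2) * Real.log x)

lemma SG_pos {x : ℝ} (hx : 0 < x) : 0 < SG x :=
  mul_pos (Real.Gamma_pos_of_pos hx) (Real.exp_pos _)

lemma SG_succ {x : ℝ} (hx : 0 < x) :
    SG (x + 1) = SG x * Real.exp (1 - (x + 1/2) * Real.log (1 + 1/x)) := by
  unfold SG
  rw [Real.Gamma_add_one hx.ne']
  have h1 : Real.log (1 + 1/x) = Real.log (x+1) - Real.log x := by
    rw [← Real.log_div (by positivity) hx.ne']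
    congr 1; field_simp; try ring
  rw [h1]
  nth_rewrite 1 [← Real.exp_log hx]
  rw [mul_comm (Real.exp _) (Real.Gamma x), mul_assoc, mul_assoc, ← Real.exp_add, ← Real.exp_add]
  congr 2; ring

lemma log_lower {x : ℝ} (hx : 0 < x) : 1 ≤ (x + 1/2) * Real.log (1 + 1/x) := by
  have h := Real.le_log_one_add_of_nonneg (x := 1/x) (by positivity)
  have h2 : (x + 1/2) * (2 * (1/x) / (1/x + 2)) = 1 := by field_simp; try ring
  have := mul_le_mul_of_nonneg_left h (show 0 ≤ x + 1/2 by positivity)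
  linarith

lemma log_upper {x : ℝ} (hx : 0 < x) :
    (x + 1/2) * Real.log (1 + 1/x) ≤ 1 + (1/(8*x) - 1/(8*(x+1))) := by
  set s := Real.log (1 + 1/x) / 2 with hs
  have hx1 : 0 < 1 / x := by positivity
  have hs0 : 0 ≤ s := by
    have := Real.log_nonneg (show 1 ≤ 1 + 1/x by linarith)
    positivity
  have h := Real.self_le_sinh_iff.2 hs0
  rw [Real.sinh_eq, Real.exp_neg] at h
  set r := Real.exp s with hr
  have hr0 : 0 < r := Real.exp_pos _
  have hr2 : r ^ 2 = 1 + 1/x := by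
    rw [hr, ← Real.exp_nat_mul, hs]
    rw [show ((2:ℕ):ℝ) * (Real.log (1 + 1/x) / 2) = Real.log (1 + 1/x) by push_cast; ring]
    exact Real.exp_log (by positivity)
  have hl : Real.log (1 + 1/x) = 2 * s := by rw [hs]; ring
  rw [hl]
  have hw : r - r⁻¹ = 1 / (x * r) := by
    have : r * r = 1 + 1/x := by rw [← hr2]; ring
    field_simp
    field_simp at hr2
    linarith
  have h3 : 2 * s ≤ 1 / (x * r) := by linarith
  have h4 : (x + 1/2) * (2 * s) ≤ (x + 1/2) * (1 / (x*r)) :=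
    mul_le_mul_of_nonneg_left h3 (by positivity)
  refine h4.trans ?_
  have h5 : (1/(8*x) - 1/(8*(x+1))) = 1 / (8 * x * (x+1)) := by field_simp; ring
  rw [h5]
  have h6 : (x * r)^2 = x * (x+1) := by rw [mul_pow, hr2]; field_simp
  set v := x * r with hv
  have hv0 : 0 < v := by positivity
  have h7 : 8 * x * (x+1) = 8 * v^2 := by rw [h6]; ring
  rw [h7]
  have h8 : x + 1/2 ≤ v + 1/(8*v) := by
    apply le_of_sq_le_sq _ (by positivity)
    have : (v + 1/(8*v))^2 = v^2 + 1/4 + (1/(8*v))^2 := by field_simp; ring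
    rw [this, h6]
    nlinarith [sq_nonneg (1/(8*v))]
  calc (x+1/2) * (1/v) ≤ (v + 1/(8*v)) * (1/v) := by gcongr
    _ = 1 + 1/(8*v^2) := by field_simp

lemma SG_le {x : ℝ} (hx : 0 < x) (n : ℕ) : SG (x + n) ≤ SG x := by
  induction n with
  | zero => simp
  | succ n ih =>
    refine le_trans ?_ ih
    have hp : 0 < x + n := by positivity
    rw [Nat.cast_succ, ← add_assoc, SG_succ hp]
    refine mul_le_of_le_one_right (SG_pos hp).le ?_
    rw [Real.exp_le_one_iff]
    linarith [log_lower hp]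

lemma SG_ge {x : ℝ} (hx : 0 < x) (n : ℕ) :
    SG x * Real.exp (-(1/(8*x))) ≤ SG (x + n) * Real.exp (-(1/(8*(x+n)))) := by
  induction n with
  | zero => simp
  | succ n ih =>
    refine ih.trans ?_
    have hp : 0 < x + n := by positivity
    rw [Nat.cast_succ, ← add_assoc, SG_succ hp, mul_assoc, ← Real.exp_add]
    refine mul_le_mul_of_nonneg_left ?_ (SG_pos hp).le
    rw [Real.exp_le_exp]
    linarith [log_upper hp]

lemma SG_bounds {ρ : ℝ} (hρ : 0 < ρ) : ∃ c C : ℝ, 0 < c ∧ 0 < C ∧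
    ∀ x, ρ ≤ x → c ≤ SG x ∧ SG x ≤ C := by
  have hcont : ContinuousOn SG (Icc ρ (ρ+1)) := by
    intro x hx
    have hx0 : 0 < x := hρ.trans_le hx.1
    have : ContinuousAt SG x := by
      unfold SG
      have h1 : ContinuousAt Real.Gamma x :=
        (Real.differentiableAt_Gamma (fun n => by
          have : (0:ℝ) ≤ n := n.cast_nonneg
          linarith)).continuousAt
      have h2 : ContinuousAt Real.log x := Real.continuousAt_log hx0.ne'
      fun_prop
    exact this.continuousWithinAt
  obtain ⟨a, ha, hamin⟩ := isCompact_Icc.exists_isMinOn ⟨ρ, by simp⟩ hcont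
  obtain ⟨b, hb, hbmax⟩ := isCompact_Icc.exists_isMaxOn ⟨ρ, by simp⟩ hcont
  refine ⟨SG a * Real.exp (-(1/(8*ρ))), SG b,
    mul_pos (SG_pos (hρ.trans_le ha.1)) (Real.exp_pos _), SG_pos (hρ.trans_le hb.1), ?_⟩
  intro x hx
  obtain ⟨n, y, hy, rfl⟩ : ∃ n : ℕ, ∃ y ∈ Icc ρ (ρ+1), x = y + n := by
    refine ⟨⌊x - ρ⌋₊, x - ⌊x - ρ⌋₊, ⟨?_, ?_⟩, by ring⟩
    · linarith [Nat.floor_le (show 0 ≤ x - ρ by linarith)]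
    · linarith [Nat.lt_floor_add_one (x - ρ)]
  have hy0 : 0 < y := hρ.trans_le hy.1
  constructor
  · have h1 := SG_ge hy0 n
    have h2 : SG (y+n) * Real.exp (-(1/(8*(y+n)))) ≤ SG (y+n) := by
      refine mul_le_of_le_one_right (SG_pos (by positivity)).le ?_
      rw [Real.exp_le_one_iff]
      have : 0 < 1/(8*(y+n)) := by positivity
      linarith
    refine le_trans ?_ (h1.trans h2)
    have h3 : SG a ≤ SG y := hamin hy
    have h4 : 1/(8*y) ≤ 1/(8*ρ) := by
      apply one_div_le_one_div_of_le (by positivity); linarith [hy.1]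
    exact mul_le_mul h3 (Real.exp_le_exp.2 (by linarith)) (Real.exp_pos _).le (SG_pos hy0).le
  · exact (SG_le hy0 n).trans (hbmax hy)

/-- The exponent of `(eα/N)^N`, with `N = n+1`. -/
def EE (α : ℝ) (n : ℕ) : ℝ := (n+1 : ℝ) + (n+1) * Real.log α - (n+1) * Real.log (n+1)

lemma EE_le {α : ℝ} (hα : 0 < α) (n : ℕ) : EE α n ≤ α := by
  have hN : (0:ℝ) < n + 1 := by positivity
  have h := Real.log_le_sub_one_of_pos (show 0 < α / (n+1) by positivity)
  rw [Real.log_div hα.ne' hN.ne'] at h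
  have h2 := mul_le_mul_of_nonneg_left h hN.le
  have h3 : ((n:ℝ)+1) * (α / (n+1) - 1) = α - (n+1) := by field_simp
  unfold EE
  nlinarith

lemma EE_ge {α : ℝ} (hα : 0 < α) (n : ℕ) : α - ((n+1) - α)^2/α ≤ EE α n := by
  have hN : (0:ℝ) < n + 1 := by positivity
  have h := Real.log_le_sub_one_of_pos (show 0 < (n+1) / α by positivity)
  rw [Real.log_div hN.ne' hα.ne'] at h
  have h2 := mul_le_mul_of_nonneg_left h hN.le
  have h3 : α - ((n+1) - α)^2/α = (n+1) - (n+1) * ((n+1)/α - 1) := by field_simp; ring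
  rw [h3]
  unfold EE
  nlinarith

lemma fact_eq (n : ℕ) : ((n+1).factorial : ℝ) =
    SG (n+1) * Real.exp (-(n+1) + (n+1+1/2) * Real.log (n+1)) := by
  have hN : (0:ℝ) < n + 1 := by positivity
  have : ((n+1).factorial : ℝ) = (n+1) * Real.Gamma (n+1) := by
    rw [Real.Gamma_nat_eq_factorial, Nat.factorial_succ]; push_cast; ring
  rw [this]
  unfold SG
  nth_rewrite 1 [← Real.exp_log hN]
  rw [mul_comm (Real.exp _) (Real.Gamma _), mul_assoc, ← Real.exp_add]
  congr 2; ring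

lemma exp_EE {α : ℝ} (hα : 0 < α) (n : ℕ) :
    Real.exp (EE α n) = SG (n+1) * Real.sqrt (n+1) * (α^(n+1) / ((n+1).factorial : ℝ)) := by
  have hN : (0:ℝ) < n + 1 := by positivity
  have hS := SG_pos hN
  rw [fact_eq, Real.sqrt_eq_rpow, Real.rpow_def_of_pos hN, ← Real.rpow_natCast,
    Real.rpow_def_of_pos hα, mul_div_assoc', _root_.eq_div_iff (by positivity), mul_left_comm,
    ← Real.exp_add, mul_assoc, ← Real.exp_add]
  congr 2; unfold EE; push_cast; ring

lemma hasSum_exp' (α : ℝ) : HasSum (fun n : ℕ => α^n / (n.factorial : ℝ)) (Real.exp α) := by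
  rw [Real.exp_eq_exp_ℝ]; exact NormedSpace.expSeries_div_hasSum_exp α

lemma exp_EE_le {α C : ℝ} (hα : 0 < α) (hC : ∀ x, 1 ≤ x → SG x ≤ C) (n : ℕ) :
    Real.exp (EE α n) ≤ C * Real.sqrt α / 2 * (α^n / (n.factorial : ℝ) +
      α^(n+1) / ((n+1).factorial : ℝ)) := by
  have hN : (0:ℝ) < n + 1 := by positivity
  have hC0 : 0 < C := (SG_pos hN).trans_le (hC _ (by linarith [n.cast_nonneg (α := ℝ)]))
  rw [exp_EE hα]
  have h1 : α^n / (n.factorial : ℝ) = (n+1)/α * (α^(n+1) / ((n+1).factorial : ℝ)) := by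
    rw [Nat.factorial_succ]; push_cast; field_simp; ring
  rw [h1]
  have h2 : Real.sqrt (n+1) ≤ Real.sqrt α / 2 * ((n+1)/α + 1) := by
    set a := Real.sqrt α with ha
    set b := Real.sqrt (n+1) with hb
    have ha0 : 0 < a := Real.sqrt_pos.2 hα
    have e1 : α = a^2 := (Real.sq_sqrt hα.le).symm
    have e2 : (n+1:ℝ) = b^2 := (Real.sq_sqrt hN.le).symm
    rw [e1, e2]
    have : a / 2 * (b^2/a^2+1) = (b^2 + a^2)/(2*a) := by field_simp
    rw [this, le_div_iff₀ (by positivity)]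
    nlinarith [sq_nonneg (a-b)]
  have h3 := mul_le_mul (hC (n+1) (by linarith [n.cast_nonneg (α := ℝ)])) h2
    (Real.sqrt_nonneg _) hC0.le
  have h4 := mul_le_mul_of_nonneg_right h3
    (show 0 ≤ α^(n+1) / ((n+1).factorial : ℝ) by positivity)
  refine h4.trans (le_of_eq ?_); ring

lemma sum_EE {α C : ℝ} (hα : 0 < α) (hC : ∀ x, 1 ≤ x → SG x ≤ C) :
    Summable (fun n => Real.exp (EE α n)) ∧
      ∑' n, Real.exp (EE α n) ≤ C * Real.sqrt α * Real.exp α := by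
  have hC0 : 0 < C := (SG_pos one_pos).trans_le (hC _ le_rfl)
  have h1 := hasSum_exp' α
  have h2 := (hasSum_nat_add_iff' 1).2 h1
  have h3 := (h1.add h2).mul_left (C * Real.sqrt α / 2)
  have hle := exp_EE_le hα hC
  have hs : Summable (fun n => Real.exp (EE α n)) :=
    Summable.of_nonneg_of_le (fun n => (Real.exp_pos _).le) hle h3.summable
  refine ⟨hs, (hs.tsum_le_tsum hle h3.summable).trans ?_⟩
  rw [h3.tsum_eq]
  simp only [Finset.range_one, Finset.sum_singleton, pow_zero, Nat.factorial_zero, Nat.cast_one,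
    div_one]
  have : 0 < C * Real.sqrt α := mul_pos hC0 (Real.sqrt_pos.2 hα)
  nlinarith

lemma term_eq {ρ t α : ℝ} (hρ : 0 < ρ) (ht : 0 < t)
    (h : Real.log t = (1+ρ) * Real.log α + ρ * Real.log ρ) (n : ℕ) :
    t^(n+1) / (Real.Gamma (ρ * ((n+1 : ℕ) : ℝ) + 0) * ((n+1).factorial : ℝ)) =
      Real.exp (1/2 * Real.log ρ) / (SG (ρ * (n+1)) * SG (n+1)) * Real.exp ((1+ρ) * EE α n) := by
  have hN : (0:ℝ) < n + 1 := by positivity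
  have hρN : 0 < ρ * (n+1) := by positivity
  have hS := SG_pos hN
  have hS2 := SG_pos hρN
  have hG : Real.Gamma (ρ * (n+1)) = SG (ρ * (n+1)) *
      Real.exp (-(ρ*(n+1)) + (ρ*(n+1) - 1/2) * (Real.log ρ + Real.log (n+1))) := by
    unfold SG
    rw [mul_assoc, ← Real.exp_add, Real.log_mul hρ.ne' hN.ne']
    have : ∀ a b : ℝ, a - b + (-a + b) = 0 := fun a b => by ring
    rw [this]; simp
  rw [add_zero, fact_eq]
  push_cast
  rw [hG, ← Real.rpow_natCast, Real.rpow_def_of_pos ht, h, div_mul_eq_mul_div,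
    div_eq_div_iff (by positivity) (by positivity)]
  have : ∀ a b c d e s r: ℝ, a + b + c = d + e → Real.exp d * Real.exp e * (s * r) =
    Real.exp a * (s * Real.exp b * (r * Real.exp c)) := by
    intro a b c d e s r h
    rw [← Real.exp_add, ← h, Real.exp_add, Real.exp_add]; ring
  symm
  rw [show Real.exp (1/2 * Real.log ρ) * Real.exp ((1+ρ) * EE α n) *
    (SG (ρ * (n+1)) * Real.exp (-(ρ*(n+1)) + (ρ*(n+1) - 1/2) * (Real.log ρ + Real.log (n+1))) *
      (SG (n+1) * Real.exp (-(n+1) + (n+1+1/2) * Real.log (n+1)))) =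
    (Real.exp (1/2 * Real.log ρ) * Real.exp ((1+ρ) * EE α n) *
      Real.exp (-(ρ*(n+1)) + (ρ*(n+1) - 1/2) * (Real.log ρ + Real.log (n+1))) *
      Real.exp (-(n+1) + (n+1+1/2) * Real.log (n+1))) * (SG (ρ * (n+1)) * SG (n+1)) by ring]
  rw [← Real.exp_add, ← Real.exp_add, ← Real.exp_add]
  congr 2
  unfold EE; push_cast; ring

/-- Wright terms, shifted. -/
def WT (ρ t : ℝ) (n : ℕ) : ℝ :=
  t^(n+1) / (Real.Gamma (ρ * ((n+1 : ℕ) : ℝ) + 0) * ((n+1).factorial : ℝ))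

lemma WT_nonneg {ρ t : ℝ} (hρ : 0 < ρ) (ht : 0 < t) (n : ℕ) : 0 ≤ WT ρ t n := by
  unfold WT
  have : 0 < Real.Gamma (ρ * ((n+1 : ℕ) : ℝ) + 0) := by
    apply Real.Gamma_pos_of_pos; positivity
  positivity

lemma WT_le {ρ t α c : ℝ} (hρ : 0 < ρ) (ht : 0 < t) (hα : 0 < α)
    (h : Real.log t = (1+ρ) * Real.log α + ρ * Real.log ρ) (hc : 0 < c)
    (hc1 : ∀ x, ρ ≤ x → c ≤ SG x) (hc2 : ∀ x, 1 ≤ x → c ≤ SG x) (n : ℕ) :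
    WT ρ t n ≤ (Real.exp (1/2 * Real.log ρ) / c^2 * Real.exp (ρ * α)) * Real.exp (EE α n) := by
  unfold WT
  rw [term_eq hρ ht h, mul_assoc, ← Real.exp_add]
  have h1 := hc1 (ρ * (n+1)) (by nlinarith [n.cast_nonneg (α := ℝ)])
  have h2 := hc2 (n+1) (by linarith [n.cast_nonneg (α := ℝ)])
  have h3 : c^2 ≤ SG (ρ * (n+1)) * SG (n+1) := by
    rw [sq]; exact mul_le_mul h1 h2 hc.le (hc.le.trans h1)
  have h4 := EE_le hα n
  gcongr
  nlinarith

lemma WT_summable {ρ t : ℝ} (hρ : 0 < ρ) (ht : 0 < t) : Summable (WT ρ t) := by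
  obtain ⟨c1, C1, hc1, hC1, hb1⟩ := SG_bounds hρ
  obtain ⟨c2, C2, hc2, hC2, hb2⟩ := SG_bounds one_pos
  have h := WT_le (α := Real.exp ((Real.log t - ρ * Real.log ρ) / (1+ρ)))
    (c := min c1 c2) hρ ht (Real.exp_pos _)
    (by rw [Real.log_exp]; field_simp; ring) (lt_min hc1 hc2)
    (fun x hx => (min_le_left _ _).trans (hb1 x hx).1)
    (fun x hx => (min_le_right _ _).trans (hb2 x hx).1)
  exact Summable.of_nonneg_of_le (WT_nonneg hρ ht) h
    ((sum_EE (Real.exp_pos _) (fun x hx => (hb2 x hx).2)).1.mul_left _)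

lemma wright_eq {ρ t : ℝ} (hρ : 0 < ρ) (ht : 0 < t) : wright ρ 0 t = ∑' n, WT ρ t n := by
  unfold wright
  rw [Summable.tsum_eq_zero_add]
  · simp [WT]
  · exact (summable_nat_add_iff 1).1 (WT_summable hρ ht)

lemma wright_asymp {ρ α₀ : ℝ} (hρ : 0 < ρ) (hα₀ : 0 < α₀) : ∃ c C : ℝ, 0 < c ∧ 0 < C ∧
    ∀ t α : ℝ, 0 < t → α₀ ≤ α → Real.log t = (1+ρ) * Real.log α + ρ * Real.log ρ →
      c * (Real.sqrt α * Real.exp ((1+ρ) * α)) ≤ wright ρ 0 t ∧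
      wright ρ 0 t ≤ C * (Real.sqrt α * Real.exp ((1+ρ) * α)) := by
  obtain ⟨c1, C1, hc1, hC1, hb1⟩ := SG_bounds hρ
  obtain ⟨c2, C2, hc2, hC2, hb2⟩ := SG_bounds one_pos
  set D := (1 / Real.sqrt α₀ + 1)^2 with hD
  refine ⟨Real.exp (1/2 * Real.log ρ) / (C1 * C2) * Real.exp (-((1+ρ) * D)),
    Real.exp (1/2 * Real.log ρ) / (min c1 c2)^2 * C2, by positivity, ?_, ?_⟩
  · have := lt_min hc1 hc2
    positivity
  intro t α ht hα0 h
  have hα : 0 < α := hα₀.trans_le hα0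
  have hsum := WT_summable hρ ht
  rw [wright_eq hρ ht]
  constructor
  · set a := ⌈α⌉₊ - 1 with ha
    have hceil : 0 < ⌈α⌉₊ := Nat.ceil_pos.2 hα
    have haR : (a:ℝ) + 1 = ⌈α⌉₊ := by
      have : a + 1 = ⌈α⌉₊ := by omega
      exact_mod_cast this
    have hs0 : 0 < Real.sqrt α := Real.sqrt_pos.2 hα
    have hs2 : Real.sqrt α ^ 2 = α := Real.sq_sqrt hα.le
    set k := ⌊Real.sqrt α⌋₊ with hk
    have hkle : (k:ℝ) ≤ Real.sqrt α := Nat.floor_le hs0.le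
    have hklt : Real.sqrt α < k + 1 := Nat.lt_floor_add_one _
    refine le_trans ?_ (hsum.sum_le_tsum (Finset.Ico a (a + (k+1)))
      (fun n _ => WT_nonneg hρ ht n))
    have key : ∀ n ∈ Finset.Ico a (a + (k+1)),
        Real.exp (1/2 * Real.log ρ) / (C1 * C2) * Real.exp ((1+ρ) * (α - D)) ≤ WT ρ t n := by
      intro n hn
      rw [Finset.mem_Ico] at hn
      unfold WT
      rw [term_eq hρ ht h]
      have hN : (0:ℝ) < n + 1 := by positivity
      have hS1 := SG_pos (show 0 < ρ * (n+1) by positivity)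
      have hS2 := SG_pos hN
      have h1 := (hb1 (ρ * (n+1)) (by nlinarith [n.cast_nonneg (α := ℝ)])).2
      have h2 := (hb2 (n+1) (by linarith [n.cast_nonneg (α := ℝ)])).2
      have hE : α - D ≤ EE α n := by
        refine le_trans ?_ (EE_ge hα n)
        have hn1 : (a:ℝ) ≤ n := by exact_mod_cast hn.1
        have hn2 : (n:ℝ) ≤ a + k := by
          have : n ≤ a + k := by omega
          exact_mod_cast this
        have hc1 := Nat.le_ceil α
        have hc2 := Nat.ceil_lt_add_one hα.le
        have hd0 : 0 ≤ (n+1:ℝ) - α := by linarith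
        have hd1 : (n+1:ℝ) - α ≤ 1 + Real.sqrt α := by linarith
        have : ((n+1:ℝ) - α)^2/α ≤ D := by
          rw [div_le_iff₀ hα]
          have e1 : ((n+1:ℝ) - α)^2 ≤ (1 + Real.sqrt α)^2 := by gcongr
          have e2 : (1 + Real.sqrt α)^2 = (1/Real.sqrt α + 1)^2 * α := by
            rw [← hs2, Real.sqrt_sq hs0.le]; field_simp
          have e3 : (1/Real.sqrt α + 1)^2 ≤ D := by
            rw [hD]
            have := Real.sqrt_pos.2 hα₀
            gcongr
          rw [e2] at e1
          exact e1.trans (mul_le_mul_of_nonneg_right e3 hα.le)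
        linarith
      gcongr
    have := Finset.card_nsmul_le_sum _ _ _ key
    refine le_trans ?_ this
    rw [Nat.card_Ico, add_tsub_cancel_left, nsmul_eq_mul]
    have e : Real.exp ((1+ρ) * (α - D)) = Real.exp (-((1+ρ)*D)) * Real.exp ((1+ρ) * α) := by
      rw [← Real.exp_add]; congr 1; ring
    rw [e]
    have hp : 0 < Real.exp (1/2 * Real.log ρ) / (C1 * C2) *
      (Real.exp (-((1+ρ)*D)) * Real.exp ((1+ρ) * α)) := by positivity
    have := mul_le_mul_of_nonneg_right hklt.le hp.le
    push_cast
    refine le_trans (le_of_eq ?_) this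
    ring
  · have hle := WT_le (c := min c1 c2) hρ ht hα h (lt_min hc1 hc2)
      (fun x hx => (min_le_left _ _).trans (hb1 x hx).1)
      (fun x hx => (min_le_right _ _).trans (hb2 x hx).1)
    obtain ⟨hs, hb⟩ := sum_EE hα (fun x hx => (hb2 x hx).2)
    refine (hsum.tsum_le_tsum hle (hs.mul_left _)).trans ?_
    rw [tsum_mul_left]
    have hm := lt_min hc1 hc2
    refine (mul_le_mul_of_nonneg_left hb (by positivity)).trans (le_of_eq ?_)
    rw [show (1+ρ) * α = ρ * α + α by ring, Real.exp_add]
    ring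

lemma enn_rearr {a b c d : ℝ≥0∞} (h1 : a ≤ b) (h2 : c ≤ d) : a * d + b * c ≤ a * c + b * d := by
  obtain ⟨e, rfl⟩ := exists_add_of_le h1
  rw [add_mul, add_mul]
  calc a * d + (a * c + e * c) = a * c + (a * d + e * c) := by ring
    _ ≤ a * c + (a * d + e * d) := by gcongr

lemma iter_meas {f : ℝ → ℝ≥0∞} (hf : Measurable f) (n : ℕ) : Measurable (iterConv1 f n) := by
  induction n with
  | zero => exact hf
  | succ n ih =>
    unfold iterConv1
    exact Measurable.lintegral_prod_right' (f := fun p : ℝ × ℝ => f (p.1 - p.2) * iterConv1 f n p.2)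
      (by fun_prop)

lemma iter_even {f : ℝ → ℝ≥0∞} (he : ∀ x, f (-x) = f x) (n : ℕ) (x : ℝ) :
    iterConv1 f n (-x) = iterConv1 f n x := by
  induction n generalizing x with
  | zero => exact he x
  | succ n ih =>
    simp only [iterConv1]
    rw [← lintegral_neg_eq_self]
    refine lintegral_congr fun y => ?_
    rw [ih, ← he (x - y)]
    congr 2; ring

lemma conv_anti {f h : ℝ → ℝ≥0∞} (hf : Measurable f) (hh : Measurable h)
    (he : ∀ x, f (-x) = f x)
    (hfa : ∀ x y, |x| ≤ |y| → f y ≤ f x) (hha : ∀ x y, |x| ≤ |y| → h y ≤ h x)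
    {x x' : ℝ} (hx : 0 ≤ x) (hxx : x ≤ x') :
    ∫⁻ y, f (x' - y) * h y ≤ ∫⁻ y, f (x - y) * h y := by
  have key : ∫⁻ y, (f (x' - y) * h y + f (x - y) * h (x + x' - y)) ≤
      ∫⁻ y, (f (x - y) * h y + f (x' - y) * h (x + x' - y)) := by
    refine lintegral_mono fun y => ?_
    rcases le_total y ((x + x')/2) with hy | hy
    · have h1 : f (x' - y) ≤ f (x - y) := hfa _ _ (sq_le_sq.1 (by nlinarith))
      have h2 : h (x + x' - y) ≤ h y := hha _ _ (sq_le_sq.1 (by nlinarith))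
      have := enn_rearr h1 h2
      calc _ = f (x' - y) * h y + f (x - y) * h (x + x' - y) := rfl
        _ ≤ f (x' - y) * h (x + x' - y) + f (x - y) * h y := this
        _ = _ := add_comm _ _
    · have h1 : f (x - y) ≤ f (x' - y) := hfa _ _ (sq_le_sq.1 (by nlinarith))
      have h2 : h y ≤ h (x + x' - y) := hha _ _ (sq_le_sq.1 (by nlinarith))
      have := enn_rearr h1 h2
      calc _ = f (x - y) * h (x + x' - y) + f (x' - y) * h y := add_comm _ _
        _ ≤ _ := this
  have e1 : ∫⁻ y, f (x - y) * h (x + x' - y) = ∫⁻ y, f (x' - y) * h y := by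
    rw [← lintegral_sub_left_eq_self (fun y => f (x' - y) * h y) (x + x')]
    refine lintegral_congr fun y => ?_
    rw [← he (x - y)]; congr 2; ring
  have e2 : ∫⁻ y, f (x' - y) * h (x + x' - y) = ∫⁻ y, f (x - y) * h y := by
    rw [← lintegral_sub_left_eq_self (fun y => f (x - y) * h y) (x + x')]
    refine lintegral_congr fun y => ?_
    rw [← he (x' - y)]; congr 2; ring
  rw [lintegral_add_left (by fun_prop), lintegral_add_left (by fun_prop), e1, e2] at key
  by_contra hlt
  push Not at hlt
  exact absurd key (not_le.2 (ENNReal.add_lt_add hlt hlt))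

lemma iter_anti {f : ℝ → ℝ≥0∞} (hf : Measurable f) (he : ∀ x, f (-x) = f x)
    (hfa : ∀ x y, |x| ≤ |y| → f y ≤ f x) (n : ℕ) (x y : ℝ) (hxy : |x| ≤ |y|) :
    iterConv1 f n y ≤ iterConv1 f n x := by
  induction n generalizing x y with
  | zero => exact hfa x y hxy
  | succ n ih =>
    have habs : ∀ z, iterConv1 f (n+1) z = iterConv1 f (n+1) |z| := by
      intro z
      rcases abs_choice z with h | h
      · rw [h]
      · rw [h, iter_even he]
    rw [habs x, habs y]
    exact conv_anti hf (iter_meas hf n) he hfa (fun a b hab => ih a b hab) (abs_nonneg x) hxy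

lemma iter_int {f : ℝ → ℝ≥0∞} (hf : Measurable f) (n : ℕ) :
    ∫⁻ x, iterConv1 f n x = (∫⁻ x, f x)^(n+1) := by
  induction n with
  | zero => simp [iterConv1]
  | succ n ih =>
    have hm := iter_meas hf n
    simp only [iterConv1]
    rw [lintegral_lintegral_swap (by fun_prop)]
    have : ∀ y, ∫⁻ x, f (x - y) * iterConv1 f n y = (∫⁻ x, f x) * iterConv1 f n y := by
      intro y
      rw [lintegral_mul_const _ (by fun_prop), lintegral_sub_right_eq_self f y]
    simp_rw [this]
    rw [lintegral_const_mul _ hm, ih]; ring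

/-- Upper bound majorant. -/
def BB (G : ℕ → ℝ → ℝ≥0∞) (Λ : ℝ≥0∞) (n : ℕ) (x : ℝ) : ℝ≥0∞ :=
  ∑ k ∈ Finset.range (n+1), ((n+1).choose (k+1) : ℝ≥0∞) * Λ^(n-k) * G k x

lemma BB_succ (G : ℕ → ℝ → ℝ≥0∞) (Λ : ℝ≥0∞) (n : ℕ) (x : ℝ) :
    BB G Λ (n+1) x = Λ^(n+1) * G 0 x +
      ∑ k ∈ Finset.range (n+1), ((n+1).choose (k+1) : ℝ≥0∞) * Λ^(n-k) * G (k+1) x +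
      Λ * BB G Λ n x := by
  have h1 : BB G Λ (n+1) x =
      ∑ k ∈ Finset.range (n+2), ((n+1).choose k : ℝ≥0∞) * Λ^(n+1-k) * G k x +
      ∑ k ∈ Finset.range (n+2), ((n+1).choose (k+1) : ℝ≥0∞) * Λ^(n+1-k) * G k x := by
    unfold BB
    rw [← Finset.sum_add_distrib]
    refine Finset.sum_congr rfl fun k _ => ?_
    rw [Nat.choose_succ_succ]; push_cast; ring
  rw [h1]
  congr 1
  · rw [Finset.sum_range_succ', add_comm]
    congr 1
    · simp
    · refine Finset.sum_congr rfl fun k _ => ?_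
      rw [Nat.add_sub_add_right]
  · rw [Finset.sum_range_succ]
    simp only [Nat.choose_succ_self, Nat.cast_zero, zero_mul, add_zero]
    unfold BB
    rw [Finset.mul_sum]
    refine Finset.sum_congr rfl fun k hk => ?_
    have : n + 1 - k = (n - k) + 1 := by
      have := Finset.mem_range.1 hk; omega
    rw [this, pow_succ]; ring

lemma iter_lower {f : ℝ → ℝ≥0∞} {G : ℕ → ℝ → ℝ≥0∞}
    (hG0 : ∀ x, 0 < x → G 0 x = f x)
    (hG : ∀ n x, 0 < x → ∫⁻ y in Ioo 0 x, f (x - y) * G n y = G (n+1) x)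
    (n : ℕ) (x : ℝ) (hx : 0 < x) : G n x ≤ iterConv1 f n x := by
  induction n generalizing x with
  | zero => exact (hG0 x hx).le
  | succ n ih =>
    rw [← hG n x hx]
    simp only [iterConv1]
    refine le_trans ?_ (setLIntegral_le_lintegral (Ioo 0 x) _)
    refine setLIntegral_mono' measurableSet_Ioo fun y hy => ?_
    exact mul_le_mul_right (ih y hy.1) _

lemma iter_upper {f : ℝ → ℝ≥0∞} {G : ℕ → ℝ → ℝ≥0∞} (hf : Measurable f)
    (he : ∀ x, f (-x) = f x) (hfa : ∀ x y, |x| ≤ |y| → f y ≤ f x)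
    (hGm : ∀ n, Measurable (G n))
    (hG0 : ∀ x, 0 < x → G 0 x = f x)
    (hG : ∀ n x, 0 < x → ∫⁻ y in Ioo 0 x, f (x - y) * G n y = G (n+1) x)
    (n : ℕ) (x : ℝ) (hx : 0 < x) : iterConv1 f n x ≤ BB G (∫⁻ y, f y) n x := by
  induction n generalizing x with
  | zero => simp [BB, iterConv1, hG0 x hx]
  | succ n ih =>
    have hm := iter_meas hf n
    have hpt : ∀ y, f (x - y) * iterConv1 f n y ≤ f x * iterConv1 f n y +
        (Ioo 0 x).indicator (fun y => f (x - y) * iterConv1 f n y) y +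
        f (x - y) * iterConv1 f n x := by
      intro y
      rcases le_or_gt y 0 with hy | hy
      · have : f (x - y) ≤ f x := hfa _ _ (by rw [abs_of_pos hx, abs_of_pos] <;> linarith)
        rw [add_assoc]
        exact (mul_le_mul_left this _).trans le_self_add
      · rcases lt_or_ge y x with hyx | hyx
        · rw [indicator_of_mem (show y ∈ Ioo 0 x from ⟨hy, hyx⟩)]
          exact le_add_self.trans le_self_add
        · have : iterConv1 f n y ≤ iterConv1 f n x :=
            iter_anti hf he hfa n _ _ (by rw [abs_of_pos hx, abs_of_pos hy]; exact hyx)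
          exact (mul_le_mul_right this _).trans le_add_self
    have hmi : Measurable ((Ioo 0 x).indicator (fun y => f (x - y) * iterConv1 f n y)) :=
      Measurable.indicator (by fun_prop) measurableSet_Ioo
    have h1 : iterConv1 f (n+1) x ≤ _ := lintegral_mono hpt
    refine h1.trans ?_
    rw [lintegral_add_right _ (by fun_prop), lintegral_add_right _ hmi, lintegral_const_mul _ hm,
      lintegral_mul_const _ (by fun_prop), lintegral_sub_left_eq_self f x, iter_int hf,
      lintegral_indicator measurableSet_Ioo, BB_succ, hG0 x hx, mul_comm (f x)]
    refine add_le_add (add_le_add le_rfl ?_) (mul_le_mul_right (ih x hx) _)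
    calc ∫⁻ y in Ioo 0 x, f (x - y) * iterConv1 f n y
        ≤ ∫⁻ y in Ioo 0 x, ∑ k ∈ Finset.range (n+1),
          ((n+1).choose (k+1) : ℝ≥0∞) * (∫⁻ y, f y)^(n-k) * (f (x - y) * G k y) := by
          refine setLIntegral_mono' measurableSet_Ioo fun y hy => ?_
          refine (mul_le_mul_right (ih y hy.1) _).trans (le_of_eq ?_)
          unfold BB
          rw [Finset.mul_sum]
          refine Finset.sum_congr rfl fun k _ => ?_
          ring
      _ = _ := by
          rw [lintegral_finsetSum _ (fun k _ => by have := hGm k; fun_prop)]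
          refine Finset.sum_congr rfl fun k _ => ?_
          rw [lintegral_const_mul _ (by have := hGm k; fun_prop), hG k x hx]

lemma ennreal_cauchy (a b : ℕ → ℝ≥0∞) :
    ∑' n, ∑ k ∈ Finset.range (n+1), a k * b (n-k) = (∑' n, a n) * ∑' n, b n := by
  simp_rw [← Finset.Nat.sum_antidiagonal_eq_sum_range_succ (fun k l => a k * b l)]
  conv_lhs => congr; ext; rw [← Finset.sum_finset_coe, ← tsum_fintype (L := .unconditional _)]
  rw [← ENNReal.tsum_sigma' (β := fun n : ℕ => (Finset.HasAntidiagonal.antidiagonal n : Set (ℕ × ℕ)))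
    (fun x => a (x.2 : ℕ × ℕ).1 * b (x.2 : ℕ × ℕ).2)]
  have := Finset.HasAntidiagonal.sigmaAntidiagonalEquivProd.tsum_eq
    (fun p : ℕ × ℕ => a p.1 * b p.2)
  refine Eq.trans this ?_
  rw [ENNReal.tsum_prod (f := fun k l => a k * b l)]
  simp_rw [ENNReal.tsum_mul_left, ENNReal.tsum_mul_right]

lemma sum_upper (lam Λ : ℝ≥0∞) (G : ℕ → ℝ → ℝ≥0∞) (x : ℝ) :
    ∑' n : ℕ, lam ^ (n + 1) * BB G Λ n x / (Nat.factorial (n + 1) : ℝ≥0∞) =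
      (∑' n : ℕ, lam ^ (n + 1) * G n x / (Nat.factorial (n + 1) : ℝ≥0∞)) *
        ∑' n : ℕ, (lam * Λ)^n / (Nat.factorial n : ℝ≥0∞) := by
  rw [← ennreal_cauchy]
  refine tsum_congr fun n => ?_
  unfold BB
  rw [Finset.mul_sum, div_eq_mul_inv, Finset.sum_mul]
  refine Finset.sum_congr rfl fun k hk => ?_
  have hk' : k ≤ n := by have := Finset.mem_range.1 hk; omega
  have hf : ((n+1).choose (k+1) : ℝ≥0∞) * ((n+1).factorial : ℝ≥0∞)⁻¹ =
      ((k+1).factorial : ℝ≥0∞)⁻¹ * ((n-k).factorial : ℝ≥0∞)⁻¹ := by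
    have h := Nat.choose_mul_factorial_mul_factorial (show k+1 ≤ n+1 by omega)
    rw [Nat.add_sub_add_right] at h
    have hne : ∀ j : ℕ, (j.factorial : ℝ≥0∞) ≠ 0 := fun j => by
      exact_mod_cast j.factorial_ne_zero
    have hnt : ∀ j : ℕ, (j.factorial : ℝ≥0∞) ≠ ⊤ := fun j => ENNReal.natCast_ne_top _
    have hc0 : ((n+1).choose (k+1) : ℝ≥0∞) ≠ 0 := by
      exact_mod_cast (Nat.choose_pos (show k+1 ≤ n+1 by omega)).ne'
    have hct : ((n+1).choose (k+1) : ℝ≥0∞) ≠ ⊤ := ENNReal.natCast_ne_top _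
    rw [← h]
    push_cast
    rw [ENNReal.mul_inv (Or.inr (hnt _)) (Or.inr (hne _)),
      ENNReal.mul_inv (Or.inr (hnt _)) (Or.inr (hne _)), mul_assoc, ← mul_assoc, 
      ENNReal.mul_inv_cancel hc0 hct, one_mul]
  have hp : lam^(n+1) = lam^(k+1) * lam^(n-k) := by rw [← pow_add]; congr 1; omega
  rw [hp, mul_pow, div_eq_mul_inv, div_eq_mul_inv]
  calc _ = (lam^(k+1) * lam^(n-k) * Λ^(n-k) * G k x) *
        (((n+1).choose (k+1) : ℝ≥0∞) * ((n+1).factorial : ℝ≥0∞)⁻¹) := by ring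
    _ = _ := by rw [hf]; ring

/-- The basic density. -/
def ff (m γ : ℝ) (x : ℝ) : ℝ≥0∞ :=
  ENNReal.ofReal (Real.exp (-m * |x|)) * ENNReal.ofReal |x| ^ (-γ)

/-- One-sided iterated convolutions. -/
def GG (m ρ : ℝ) (n : ℕ) (x : ℝ) : ℝ≥0∞ :=
  ENNReal.ofReal (Real.exp (-m * x) * (Real.Gamma ρ^(n+1) / Real.Gamma (ρ * (n+1))) *
    x ^ (ρ * (n+1) - 1))

lemma ff_meas (m γ : ℝ) : Measurable (ff m γ) := by
  unfold ff
  fun_prop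

lemma GG_meas (m ρ : ℝ) (n : ℕ) : Measurable (GG m ρ n) := by
  unfold GG
  fun_prop

lemma ff_even (m γ x : ℝ) : ff m γ (-x) = ff m γ x := by simp [ff]

lemma ff_anti {m γ : ℝ} (hm : 0 < m) (hγ : 0 ≤ γ) (x y : ℝ) (h : |x| ≤ |y|) :
    ff m γ y ≤ ff m γ x := by
  unfold ff
  refine mul_le_mul' (ENNReal.ofReal_le_ofReal (Real.exp_le_exp.2 (by nlinarith))) ?_
  rw [ENNReal.rpow_neg, ENNReal.rpow_neg]
  exact ENNReal.inv_le_inv.2 (ENNReal.rpow_le_rpow (ENNReal.ofReal_le_ofReal h) hγ)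

lemma ff_pos {m γ x : ℝ} (hx : 0 < x) :
    ff m γ x = ENNReal.ofReal (Real.exp (-m * x) * x ^ (-γ)) := by
  unfold ff
  rw [abs_of_pos hx, ENNReal.ofReal_rpow_of_pos hx, ← ENNReal.ofReal_mul (Real.exp_pos _).le]

lemma GG_zero {m γ : ℝ} (hγ : γ < 1) (x : ℝ) (hx : 0 < x) : GG m (1-γ) 0 x = ff m γ x := by
  rw [ff_pos hx]
  unfold GG
  have := Real.Gamma_pos_of_pos (show 0 < 1 - γ by linarith)
  congr 1
  simp [this.ne']

lemma beta_scale {a b x : ℝ} (ha : 0 < a) (hb : 0 < b) (hx : 0 < x) :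
    ∫⁻ y in Ioo 0 x, ENNReal.ofReal (y^(a-1) * (x-y)^(b-1)) =
      ENNReal.ofReal (ProbabilityTheory.beta a b * x^(a+b-1)) := by
  have hB := ProbabilityTheory.beta_pos ha hb
  have h1 : ∫⁻ y, ProbabilityTheory.betaPDF a b (x⁻¹ * y) = ENNReal.ofReal x := by
    have hm : Measurable (ProbabilityTheory.betaPDF a b) := by
      unfold ProbabilityTheory.betaPDF
      exact (ProbabilityTheory.measurable_betaPDFReal a b).ennreal_ofReal
    rw [← lintegral_map hm (by fun_prop : Measurable (fun y : ℝ => x⁻¹ * y)),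
      Real.map_volume_mul_left (by positivity), lintegral_smul_measure,
      ProbabilityTheory.lintegral_betaPDF_eq_one ha hb]
    simp [abs_of_pos hx]
  have h2 : ∀ y, (Ioo 0 x).indicator (fun y => ENNReal.ofReal (y^(a-1) * (x-y)^(b-1))) y =
      ENNReal.ofReal (ProbabilityTheory.beta a b * x^(a+b-2)) *
        ProbabilityTheory.betaPDF a b (x⁻¹ * y) := by
    intro y
    by_cases hy : y ∈ Ioo 0 x
    · rw [indicator_of_mem hy, ProbabilityTheory.betaPDF_of_pos_lt_one (by have := hy.1; positivity)
        (by rw [inv_mul_lt_iff₀ hx]; simpa using hy.2), ← ENNReal.ofReal_mul (by positivity)]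
      congr 1
      have hxy : 0 < x - y := by linarith [hy.2]
      rw [show 1 - x⁻¹ * y = x⁻¹ * (x - y) by field_simp,
        Real.mul_rpow (by positivity) hy.1.le, Real.mul_rpow (by positivity) hxy.le,
        show a + b - 2 = (a-1) + (b-1) by ring, Real.rpow_add hx, Real.inv_rpow hx.le,
        Real.inv_rpow hx.le]
      have := Real.rpow_pos_of_pos hx (a-1)
      have := Real.rpow_pos_of_pos hx (b-1)
      field_simp
    · rw [indicator_of_notMem hy]
      rcases le_or_gt y 0 with h | h
      · rw [ProbabilityTheory.betaPDF_eq_zero_of_nonpos, mul_zero]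
        exact mul_nonpos_of_nonneg_of_nonpos (by positivity) h
      · rw [ProbabilityTheory.betaPDF_eq_zero_of_one_le, mul_zero]
        have : x ≤ y := by
          by_contra hc
          exact hy ⟨h, not_le.1 hc⟩
        rw [le_inv_mul_iff₀ hx]; simpa using this
  rw [← lintegral_indicator measurableSet_Ioo]
  simp_rw [h2]
  rw [lintegral_const_mul', h1, ← ENNReal.ofReal_mul (by positivity)]
  · congr 1
    rw [mul_assoc, show a + b - 1 = (a+b-2) + 1 by ring, Real.rpow_add_one hx.ne']
  · exact ENNReal.ofReal_ne_top

lemma GG_succ {m γ : ℝ} (hγ : γ < 1) (n : ℕ) (x : ℝ) (hx : 0 < x) :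
    ∫⁻ y in Ioo 0 x, ff m γ (x - y) * GG m (1-γ) n y = GG m (1-γ) (n+1) x := by
  set ρ := 1 - γ with hρd
  have hρ : 0 < ρ := by rw [hρd]; linarith
  have hG := Real.Gamma_pos_of_pos hρ
  have ha : 0 < ρ * (n+1) := by positivity
  have hGa := Real.Gamma_pos_of_pos ha
  have hGb := Real.Gamma_pos_of_pos (add_pos ha hρ)
  have h1 : ∫⁻ y in Ioo 0 x, ff m γ (x - y) * GG m ρ n y =
      ∫⁻ y in Ioo 0 x, ENNReal.ofReal (Real.exp (-m*x) *
        (Real.Gamma ρ^(n+1) / Real.Gamma (ρ * (n+1)))) *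
        ENNReal.ofReal (y^(ρ * (n+1) - 1) * (x-y)^(ρ-1)) := by
    refine setLIntegral_congr_fun measurableSet_Ioo fun y hy => ?_
    have hxy : 0 < x - y := by linarith [hy.2]
    have hy0 : 0 < y := hy.1
    rw [ff_pos hxy, GG, ← ENNReal.ofReal_mul (by positivity), ← ENNReal.ofReal_mul (by positivity)]
    congr 1
    rw [show -m * x = -m * (x - y) + -m * y by ring, Real.exp_add, show ρ - 1 = -γ by rw [hρd]; ring]
    ring
  rw [h1, lintegral_const_mul' _ _ ENNReal.ofReal_ne_top, beta_scale ha hρ hx,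
    ← ENNReal.ofReal_mul (by positivity), GG]
  congr 1
  have e : ρ * (((n+1 : ℕ) : ℝ) + 1) = ρ * (n+1) + ρ := by push_cast; ring
  rw [e, ProbabilityTheory.beta, pow_succ (Real.Gamma ρ) (n+1)]
  field_simp

lemma ff_int {m γ : ℝ} (hm : 0 < m) (hγ : γ < 1) : ∫⁻ x, ff m γ x ≠ ⊤ := by
  set g : ℝ → ℝ≥0∞ := (Ioi 0).indicator (ff m γ) with hg
  have hgm : Measurable g := (ff_meas m γ).indicator measurableSet_Ioi
  have hgfin : ∫⁻ x, g x ≠ ⊤ := by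
    rw [hg, lintegral_indicator measurableSet_Ioi]
    have hi := integrableOn_rpow_mul_exp_neg_mul_rpow (s := -γ) (p := 1) (b := m)
      (by linarith) one_pos hm
    have : ∫⁻ x in Ioi 0, ff m γ x =
        ∫⁻ x in Ioi 0, ENNReal.ofReal (x ^ (-γ) * Real.exp (-m * x ^ (1:ℝ))) := by
      refine setLIntegral_congr_fun measurableSet_Ioi fun x hx => ?_
      rw [ff_pos hx, Real.rpow_one, mul_comm]
    rw [this]
    exact (Integrable.lintegral_lt_top hi).ne
  have hle : ∫⁻ x, ff m γ x ≤ ∫⁻ x, (g x + g (-x)) := by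
    refine lintegral_mono_ae ?_
    have : ∀ᵐ x : ℝ, x ≠ 0 := by
      simp [ae_iff]
    filter_upwards [this] with x hx
    rcases lt_or_gt_of_ne hx with h | h
    · rw [hg, indicator_of_mem (show -x ∈ Ioi 0 by simpa using h), ff_even]
      exact le_add_self
    · rw [hg, indicator_of_mem (show x ∈ Ioi 0 from h)]
      exact le_self_add
  rw [lintegral_add_left hgm, lintegral_neg_eq_self] at hle
  exact ne_top_of_le_ne_top (ENNReal.add_ne_top.2 ⟨hgfin, hgfin⟩) hle

lemma exp_series (a : ℝ) (ha : 0 ≤ a) :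
    ∑' n : ℕ, (ENNReal.ofReal a)^n / (Nat.factorial n : ℝ≥0∞) = ENNReal.ofReal (Real.exp a) := by
  rw [← (hasSum_exp' a).tsum_eq, ENNReal.ofReal_tsum_of_nonneg (fun n => by positivity)
    (hasSum_exp' a).summable]
  refine tsum_congr fun n => ?_
  rw [ENNReal.ofReal_div_of_pos (by positivity), ENNReal.ofReal_pow ha, ENNReal.ofReal_natCast]

lemma GG_sum {m ρ lam x : ℝ} (hρ : 0 < ρ) (hl : 0 < lam) (hx : 0 < x) :
    ∑' n : ℕ, ENNReal.ofReal lam ^ (n + 1) * GG m ρ n x / (Nat.factorial (n + 1) : ℝ≥0∞) =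
      ENNReal.ofReal (Real.exp (-m*x) * x⁻¹ * wright ρ 0 (Real.Gamma ρ * lam * x^ρ)) := by
  have hG := Real.Gamma_pos_of_pos hρ
  have ht : 0 < Real.Gamma ρ * lam * x^ρ := by positivity
  rw [wright_eq hρ ht, ← tsum_mul_left, ENNReal.ofReal_tsum_of_nonneg
    (fun n => mul_nonneg (by positivity) (WT_nonneg hρ ht n)) ((WT_summable hρ ht).mul_left _)]
  refine tsum_congr fun n => ?_
  have hGa := Real.Gamma_pos_of_pos (show 0 < ρ * ((n:ℝ)+1) by positivity)
  rw [GG, ← ENNReal.ofReal_pow hl.le, ← ENNReal.ofReal_mul (by positivity),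
    ← ENNReal.ofReal_natCast, ← ENNReal.ofReal_div_of_pos (by positivity)]
  congr 1
  unfold WT
  have e : x ^ (ρ * ((n:ℝ)+1) - 1) = (x^ρ)^(n+1) * x⁻¹ := by
    rw [Real.rpow_sub_one hx.ne', Real.rpow_mul hx.le, div_eq_mul_inv]
    congr 1
    exact_mod_cast Real.rpow_natCast (x^ρ) (n+1)
  rw [e, add_zero]
  push_cast
  field_simp
  rw [mul_pow, mul_pow]
  ring

lemma pdens_bounds {m γ : ℝ} (hm : 0 < m) (hγ0 : 0 ≤ γ) (hγ1 : γ < 1) (x lam L : ℝ)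
    (hL : L = (∫⁻ y, ff m γ y).toReal)
    (hx : 1 ≤ |x|) (hl : 0 < lam) :
    ENNReal.ofReal (Real.exp (-(lam * L) - m * |x|) * |x|⁻¹ *
          wright (1 - γ) 0 (Real.Gamma (1 - γ) * lam * |x| ^ (1 - γ))) ≤ pdens1 (ff m γ) lam x ∧
      pdens1 (ff m γ) lam x ≤ ENNReal.ofReal (Real.exp (L * lam)) *
        ENNReal.ofReal (Real.exp (-(lam * L) - m * |x|) * |x|⁻¹ *
          wright (1 - γ) 0 (Real.Gamma (1 - γ) * lam * |x| ^ (1 - γ))) := by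
  have hρ : 0 < 1 - γ := by linarith
  have hx0 : 0 < |x| := by linarith
  have hit : ∀ n, iterConv1 (ff m γ) n x = iterConv1 (ff m γ) n |x| := by
    intro n
    rcases abs_choice x with h | h
    · rw [h]
    · rw [h, iter_even (ff_even m γ)]
  have hL0 : 0 ≤ L := by rw [hL]; exact ENNReal.toReal_nonneg
  have hΛ : ∫⁻ y, ff m γ y = ENNReal.ofReal L := by
    rw [hL, ENNReal.ofReal_toReal (ff_int hm hγ1)]
  have hs : Real.exp (-(lam * L) - m * |x|) * |x|⁻¹ *
      wright (1 - γ) 0 (Real.Gamma (1 - γ) * lam * |x| ^ (1 - γ)) = Real.exp (-(lam * L)) *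
      (Real.exp (-m*|x|) * |x|⁻¹ *
      wright (1 - γ) 0 (Real.Gamma (1 - γ) * lam * |x| ^ (1 - γ))) := by
    rw [sub_eq_add_neg, Real.exp_add, neg_mul]; ring
  rw [hs, ENNReal.ofReal_mul (Real.exp_pos _).le, ← GG_sum hρ hl hx0]
  unfold pdens1
  rw [← hL]
  simp_rw [hit]
  constructor
  · refine mul_le_mul_right (ENNReal.tsum_le_tsum fun n => ?_) _
    refine ENNReal.div_le_div_right (mul_le_mul_right ?_ _) _
    exact iter_lower (GG_zero hγ1) (GG_succ hγ1) n _ hx0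
  · rw [mul_left_comm]
    refine mul_le_mul_right ?_ _
    rw [mul_comm L lam, ← exp_series _ (by positivity), ENNReal.ofReal_mul hl.le, mul_comm,
      ← sum_upper, ← hΛ]
    refine ENNReal.tsum_le_tsum fun n => ?_
    refine ENNReal.div_le_div_right (mul_le_mul_right ?_ _) _
    exact iter_upper (ff_meas m γ) (ff_even m γ) (ff_anti hm hγ0) (GG_meas m (1-γ))
      (GG_zero hγ1) (GG_succ hγ1) n _ hx0

lemma wright_small_lower {ρ s : ℝ} (hρ : 0 < ρ) (hs : 0 < s) :
    s ≤ wright ρ 0 (Real.Gamma ρ * s) := by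
  have hG := Real.Gamma_pos_of_pos hρ
  have ht : 0 < Real.Gamma ρ * s := by positivity
  rw [wright_eq hρ ht]
  refine le_trans (le_of_eq ?_) ((WT_summable hρ ht).le_tsum 0 (fun n _ => WT_nonneg hρ ht n))
  unfold WT
  simp
  field_simp

lemma wright_small_upper {ρ s : ℝ} (hρ : 0 < ρ) (hs : 0 < s) (hs1 : s ≤ 1) :
    wright ρ 0 (Real.Gamma ρ * s) ≤ s * wright ρ 0 (Real.Gamma ρ) := by
  have hG := Real.Gamma_pos_of_pos hρ
  have ht : 0 < Real.Gamma ρ * s := by positivity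
  rw [wright_eq hρ ht, wright_eq hρ hG, ← tsum_mul_left]
  refine (WT_summable hρ ht).tsum_le_tsum (fun n => ?_) ((WT_summable hρ hG).mul_left _)
  have h0 := WT_nonneg hρ hG n
  have : WT ρ (Real.Gamma ρ * s) n = s^(n+1) * WT ρ (Real.Gamma ρ) n := by
    unfold WT; rw [mul_pow]; ring
  rw [this]
  refine mul_le_mul_of_nonneg_right ?_ h0
  rw [pow_succ]
  exact mul_le_of_le_one_left hs.le (pow_le_one₀ hs.le hs1)

lemma wright_large {γ : ℝ} (hγ1 : γ < 1) : ∃ c C : ℝ, 0 < c ∧ 0 < C ∧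
    ∀ s : ℝ, 1 ≤ s →
      c * (s ^ (1/(4-2*γ)) * Real.exp (((2-γ)/(1-γ)) * (Real.Gamma (2-γ) * s)^(1/(2-γ)))) ≤
        wright (1-γ) 0 (Real.Gamma (1-γ) * s) ∧
      wright (1-γ) 0 (Real.Gamma (1-γ) * s) ≤
      C * (s ^ (1/(4-2*γ)) * Real.exp (((2-γ)/(1-γ)) * (Real.Gamma (2-γ) * s)^(1/(2-γ)))) := by
  have hρ : 0 < 1 - γ := by linarith
  have h2 : 0 < 2 - γ := by linarith
  have h4 : 0 < 4 - 2 * γ := by linarith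
  have hG1 := Real.Gamma_pos_of_pos hρ
  have hG2 := Real.Gamma_pos_of_pos h2
  have hGG : Real.Gamma (2-γ) = (1-γ) * Real.Gamma (1-γ) := by
    rw [show 2 - γ = (1-γ) + 1 by ring, Real.Gamma_add_one hρ.ne']
  set α₀ := Real.Gamma (2-γ)^(1/(2-γ)) / (1-γ) with hα₀d
  have hα₀ : 0 < α₀ := by positivity
  obtain ⟨c, C, hc, hC, hb⟩ := wright_asymp hρ hα₀
  have hK : 0 < Real.sqrt α₀ := Real.sqrt_pos.2 hα₀
  refine ⟨c * Real.sqrt α₀, C * Real.sqrt α₀, by positivity, by positivity, ?_⟩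
  intro s hs
  have hs0 : 0 < s := by linarith
  have hα : (Real.Gamma (2-γ) * s)^(1/(2-γ)) / (1-γ) = α₀ * s^(1/(2-γ)) := by
    rw [Real.mul_rpow hG2.le hs0.le, hα₀d]; ring
  have hge : α₀ ≤ (Real.Gamma (2-γ) * s)^(1/(2-γ)) / (1-γ) := by
    rw [hα]
    exact le_mul_of_one_le_right hα₀.le (Real.one_le_rpow hs (by positivity))
  have hlog : Real.log (Real.Gamma (1-γ) * s) =
      (1+(1-γ)) * Real.log ((Real.Gamma (2-γ) * s)^(1/(2-γ)) / (1-γ)) +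
        (1-γ) * Real.log (1-γ) := by
    rw [Real.log_div (by positivity) hρ.ne', Real.log_rpow (by positivity),
      Real.log_mul hG1.ne' hs0.ne', Real.log_mul hG2.ne' hs0.ne', hGG,
      Real.log_mul hρ.ne' hG1.ne', show 1 + (1-γ) = 2 - γ by ring]
    field_simp
    ring
  have := hb _ _ (by positivity) hge hlog
  have hsq : Real.sqrt ((Real.Gamma (2-γ) * s)^(1/(2-γ)) / (1-γ)) =
      Real.sqrt α₀ * s^(1/(4-2*γ)) := by
    rw [hα, Real.sqrt_mul hα₀.le, Real.sqrt_eq_rpow (s^(1/(2-γ))), ← Real.rpow_mul hs0.le]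
    congr 2
    field_simp
    ring
  have hex : (1+(1-γ)) * ((Real.Gamma (2-γ) * s)^(1/(2-γ)) / (1-γ)) =
      ((2-γ)/(1-γ)) * (Real.Gamma (2-γ) * s)^(1/(2-γ)) := by ring
  rw [hsq, hex] at this
  constructor
  · refine le_trans (le_of_eq ?_) this.1; ring
  · refine this.2.trans (le_of_eq ?_); ring

/-- Let `d = 1`, `m > 0`, `γ ∈ [0,1)`, `f(x) = e^{−m|x|}|x|^{−γ}` and
`M₂ = (C₁ ∨ C₂)·‖f‖₁`. Then for `|x| ≥ 1`, `λ > 0`: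
`1 ≤ p_λ(x)/(e^{−λ‖f‖₁} e^{−m|x|}|x|^{−1} φ(1−γ,0;Γ(1−γ)λ|x|^{1−γ})) ≤ e^{M₂λ}`,
and the resulting two-regime two-sided bounds hold with constants `E₁,…,E₄ > 0`. -/
theorem stmt16 (m γ : ℝ) (hm : 0 < m) (hγ0 : 0 ≤ γ) (hγ1 : γ < 1)
    (f : ℝ → ℝ≥0∞)
    (hf : ∀ x : ℝ, f x = ENNReal.ofReal (Real.exp (-m * |x|)) * ENNReal.ofReal |x| ^ (-γ))
    (C₁ C₂ : ℝ) (hC₁ : 1 ≤ C₁) (hC₂ : 1 ≤ C₂)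
    (hC1f : ∀ x y : ℝ, 1 ≤ |x| → |x| ≤ |y| → |y| ≤ |x| + 1 → f x ≤ ENNReal.ofReal C₁ * f y)
    (hC2f : ∀ x : ℝ, |x| ≤ 1 → f x ≤ ENNReal.ofReal C₂ * f (2 * x))
    (L : ℝ) (hL : L = (∫⁻ y, f y).toReal)
    (M₂ : ℝ) (hM₂ : M₂ = max C₁ C₂ * L) :
    (∀ x lam : ℝ, 1 ≤ |x| → 0 < lam →
      ENNReal.ofReal (Real.exp (-(lam * L) - m * |x|) * |x|⁻¹ *
          wright (1 - γ) 0 (Real.Gamma (1 - γ) * lam * |x| ^ (1 - γ))) ≤ pdens1 f lam x ∧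
      pdens1 f lam x ≤ ENNReal.ofReal (Real.exp (M₂ * lam)) *
        ENNReal.ofReal (Real.exp (-(lam * L) - m * |x|) * |x|⁻¹ *
          wright (1 - γ) 0 (Real.Gamma (1 - γ) * lam * |x| ^ (1 - γ)))) ∧
    (∃ E₁ E₂ E₃ E₄ : ℝ, 0 < E₁ ∧ 0 < E₂ ∧ 0 < E₃ ∧ 0 < E₄ ∧
      ∀ x lam : ℝ, 1 ≤ |x| → 0 < lam →
        (lam * |x| ^ (1 - γ) ≤ 1 →
          ENNReal.ofReal (E₁ * (lam * Real.exp (-(lam * L) - m * |x|) * |x| ^ (-γ))) ≤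
            pdens1 f lam x ∧
          pdens1 f lam x ≤
            ENNReal.ofReal (E₂ * (lam * Real.exp (-(lam * L) - m * |x|) * |x| ^ (-γ)))) ∧
        (1 ≤ lam * |x| ^ (1 - γ) →
          ENNReal.ofReal (E₃ * (lam ^ (1 / (4 - 2 * γ)) * |x| ^ (-(3 - γ) / (4 - 2 * γ)) *
              Real.exp (-(lam * L) - m * |x| +
                ((2 - γ) / (1 - γ)) *
                  (Real.Gamma (2 - γ) * lam * |x| ^ (1 - γ)) ^ (1 / (2 - γ))))) ≤
            pdens1 f lam x ∧
          pdens1 f lam x ≤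
            ENNReal.ofReal (E₄ * Real.exp (M₂ * lam) *
              (lam ^ (1 / (4 - 2 * γ)) * |x| ^ (-(3 - γ) / (4 - 2 * γ)) *
                Real.exp (-(lam * L) - m * |x| +
                  ((2 - γ) / (1 - γ)) *
                    (Real.Gamma (2 - γ) * lam * |x| ^ (1 - γ)) ^ (1 / (2 - γ))))))) := by
  obtain rfl : f = ff m γ := funext hf
  have hρ : 0 < 1 - γ := by linarith
  have hG1 := Real.Gamma_pos_of_pos hρ
  have hL0 : 0 ≤ L := by rw [hL]; exact ENNReal.toReal_nonneg
  have hLM : L ≤ M₂ := by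
    rw [hM₂]
    exact le_mul_of_one_le_left hL0 (hC₁.trans (le_max_left _ _))
  have hmain : ∀ x lam : ℝ, 1 ≤ |x| → 0 < lam →
      ENNReal.ofReal (Real.exp (-(lam * L) - m * |x|) * |x|⁻¹ *
          wright (1 - γ) 0 (Real.Gamma (1 - γ) * lam * |x| ^ (1 - γ))) ≤ pdens1 (ff m γ) lam x ∧
      pdens1 (ff m γ) lam x ≤ ENNReal.ofReal (Real.exp (M₂ * lam)) *
        ENNReal.ofReal (Real.exp (-(lam * L) - m * |x|) * |x|⁻¹ *
          wright (1 - γ) 0 (Real.Gamma (1 - γ) * lam * |x| ^ (1 - γ))) := by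
    intro x lam hx hl
    obtain ⟨h1, h2⟩ := pdens_bounds hm hγ0 hγ1 x lam L hL hx hl
    refine ⟨h1, h2.trans (mul_le_mul_left (ENNReal.ofReal_le_ofReal (Real.exp_le_exp.2 ?_)) _)⟩
    exact mul_le_mul_of_nonneg_right hLM hl.le
  refine ⟨hmain, ?_⟩
  obtain ⟨c, C, hc, hC, hlarge⟩ := wright_large hγ1
  have hW : 0 < wright (1-γ) 0 (Real.Gamma (1-γ)) := by
    have := wright_small_lower hρ one_pos
    rw [mul_one] at this
    linarith
  refine ⟨1, Real.exp M₂ * wright (1-γ) 0 (Real.Gamma (1-γ)), c, C, one_pos, by positivity, hc, hC,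
    ?_⟩
  intro x lam hx hl
  have hx0 : 0 < |x| := by linarith
  obtain ⟨h1, h2⟩ := hmain x lam hx hl
  set X := |x| with hX
  set s := lam * X^(1-γ) with hs
  have hs0 : 0 < s := by positivity
  have hts : Real.Gamma (1-γ) * lam * X^(1-γ) = Real.Gamma (1-γ) * s := by rw [hs]; ring
  rw [hts] at h1 h2
  have hXs : X⁻¹ * s = lam * X^(-γ) := by
    rw [hs, show (1-γ) = -γ + 1 by ring, Real.rpow_add_one hx0.ne']
    field_simp
  constructor
  · intro hle
    constructor
    · refine le_trans (ENNReal.ofReal_le_ofReal ?_) h1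
      have := wright_small_lower hρ hs0
      calc 1 * (lam * Real.exp (-(lam * L) - m * X) * X^(-γ))
          = Real.exp (-(lam * L) - m * X) * (X⁻¹ * s) := by rw [hXs]; ring
        _ ≤ Real.exp (-(lam * L) - m * X) * (X⁻¹ * wright (1-γ) 0 (Real.Gamma (1-γ) * s)) := by
          gcongr
        _ = _ := by ring
    · refine h2.trans ?_
      rw [← ENNReal.ofReal_mul (Real.exp_pos _).le]
      refine ENNReal.ofReal_le_ofReal ?_
      have hu := wright_small_upper hρ hs0 hle
      have hl1 : lam ≤ 1 := by
        refine le_trans ?_ hle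
        exact le_mul_of_one_le_right hl.le (Real.one_le_rpow hx hρ.le)
      have hM : M₂ * lam ≤ M₂ := mul_le_of_le_one_right (hL0.trans hLM) hl1
      calc Real.exp (M₂ * lam) * (Real.exp (-(lam * L) - m * X) * X⁻¹ *
            wright (1-γ) 0 (Real.Gamma (1-γ) * s))
          ≤ Real.exp M₂ * (Real.exp (-(lam * L) - m * X) * X⁻¹ *
            (s * wright (1-γ) 0 (Real.Gamma (1-γ)))) := by
            have : 0 ≤ wright (1-γ) 0 (Real.Gamma (1-γ) * s) :=
              hs0.le.trans (wright_small_lower hρ hs0)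
            gcongr
        _ = Real.exp M₂ * Real.exp (-(lam * L) - m * X) * (X⁻¹ * s) *
              wright (1-γ) 0 (Real.Gamma (1-γ)) := by ring
        _ = _ := by rw [hXs]; ring
  · intro hge
    obtain ⟨hl1, hl2⟩ := hlarge s hge
    have h4 : 0 < 4 - 2 * γ := by linarith
    have hd : (4 - 2 * γ) * (1 / (4 - 2 * γ)) = 1 := mul_one_div_cancel h4.ne'
    have hXp : lam ^ (1/(4-2*γ)) * X ^ (-(3-γ)/(4-2*γ)) = X⁻¹ * s^(1/(4-2*γ)) := by
      rw [hs, Real.mul_rpow hl.le (by positivity), ← Real.rpow_mul hx0.le,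
        show -(3-γ)/(4-2*γ) = (1-γ) * (1/(4-2*γ)) + (-1) by
          rw [div_eq_mul_one_div]; linear_combination -hd,
        Real.rpow_add hx0, Real.rpow_neg_one]
      ring
    have hex : Real.exp (-(lam * L) - m * X + ((2 - γ) / (1 - γ)) *
        (Real.Gamma (2 - γ) * lam * X ^ (1 - γ)) ^ (1 / (2 - γ))) =
        Real.exp (-(lam * L) - m * X) * Real.exp (((2 - γ) / (1 - γ)) *
        (Real.Gamma (2 - γ) * s) ^ (1 / (2 - γ))) := by
      rw [Real.exp_add, hs, mul_assoc (Real.Gamma (2-γ))]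
    rw [hXp, hex]
    constructor
    · refine le_trans (ENNReal.ofReal_le_ofReal ?_) h1
      have := mul_le_mul_of_nonneg_left hl1
        (show 0 ≤ Real.exp (-(lam * L) - m * X) * X⁻¹ by positivity)
      refine le_trans (le_of_eq ?_) this
      ring
    · refine h2.trans ?_
      rw [← ENNReal.ofReal_mul (Real.exp_pos _).le]
      refine ENNReal.ofReal_le_ofReal ?_
      have := mul_le_mul_of_nonneg_left hl2
        (show 0 ≤ Real.exp (M₂ * lam) * (Real.exp (-(lam * L) - m * X) * X⁻¹) by positivity)
      refine le_trans (le_of_eq ?_) (this.trans (le_of_eq ?_))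
      · ring
      · ring
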